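/- arXiv:1209.6206 — 2 statements merged into one kernel-verified Lean document; each statement's English description precedes it below -/
import Mathlib

section
/- (Main Theorem) In the n-soliton setup, let ν₁, …, νₙ ∈ ℝ be filling rates. Then the gap equation holds, i.e. for every x ∈ ℝ one has 0 = Σ_{j=1}^{n} ν_j·s_j⁻¹·f_j(x)² + [ ∫_{−∞}^{0} ds/(2π) − ∫_{0}^{∞} ds/(2π) ] ( (m/2)·u(x,s)·conj(v(x,s)) − Δ(x)/(2s) ), if and only if ν_j = (2θ_j − π)/π for every j = 1, …, n. Here u(x,s) = exp(i·k(s)·x)·[ 1 + (2i/m)·Σ_{j=1}^{n} e_j(x)·f_j(x)/(s_j − s) ] and v(x,s) = exp(i·k(s)·x)·[ s⁻¹ + (2i/m)·Σ_{j=1}^{n} e_j(x)·s_j·conj(f_j(x))/(s_j − s) ] are the scattering states, with k(s) = (m/2)(s − s⁻¹), and the integrand is integrable on (−∞,0) and (0,∞) for every x. -/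
open Matrix MeasureTheory Filter Topology

/-- Partial fraction expansion of a product of two rational functions with poles at the points
`s j`, respectively at `0` and the points `(s j)⁻¹`. -/
lemma mul_partial_fractions {K ι : Type*} [Field K] [Fintype ι] (s a : ι → K) (r : K)
    (hr : r ≠ 0) (hs : ∀ j, s j ≠ 0) (hsr : ∀ j, s j - r ≠ 0) (htr : ∀ j, r - (s j)⁻¹ ≠ 0)
    (hst : ∀ j l, s j - (s l)⁻¹ ≠ 0) :
    (1 + ∑ j, a j / (s j - r)) * (r⁻¹ + ∑ j, a j * (s j)⁻¹ / (r - (s j)⁻¹))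
        - (1 + ∑ j, a j * (s j)⁻¹) / r
      = ∑ j, a j * (s j)⁻¹ * (1 + ∑ l, a l / (s l - (s j)⁻¹))
          * (1 / (r - (s j)⁻¹) - 1 / (r - s j)) := by
  have hrs : ∀ j, r - s j ≠ 0 := fun j h => hsr j (by rw [← neg_sub, h, neg_zero])
  have hsingle : ∀ j, a j / (s j - r) * r⁻¹
      = a j * (s j)⁻¹ / r - a j * (s j)⁻¹ * (1 / (r - s j)) := by
    intro j
    have h1 := hs j
    have h2 := hsr j
    have h3 := hrs j
    field_simp
    ring
  have hdouble : ∀ j l, a j / (s j - r) * (a l * (s l)⁻¹ / (r - (s l)⁻¹))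
      = a l * (s l)⁻¹ * (a j / (s j - (s l)⁻¹)) * (1 / (r - (s l)⁻¹))
        - a j * (s j)⁻¹ * (a l / (s l - (s j)⁻¹)) * (1 / (r - s j)) := by
    intro j l
    have hl : s l * s j - 1 ≠ 0 := fun h => hst j l (by
      rw [sub_eq_zero] at h ⊢
      exact eq_inv_of_mul_eq_one_right h)
    have e1 : s j - (s l)⁻¹ = (s l * s j - 1) / s l := by
      have := hs l
      field_simp
    have e2 : s l - (s j)⁻¹ = (s l * s j - 1) / s j := by
      have := hs j
      field_simp
    have e3 : r - (s l)⁻¹ = (r * s l - 1) / s l := by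
      have := hs l
      field_simp
    have h3 : r * s l - 1 ≠ 0 := fun h => htr l (by rw [e3, h, zero_div])
    have e4 : r - s j = -(s j - r) := by ring
    have hl' : s j * s l - 1 ≠ 0 := by rwa [mul_comm]
    rw [e1, e2, e3, e4]
    have := hs j
    have := hs l
    have := hsr j
    field_simp
    ring
  have hD : (∑ j, a j / (s j - r)) * ∑ l, a l * (s l)⁻¹ / (r - (s l)⁻¹)
      = ∑ j, a j * (s j)⁻¹ * (∑ l, a l / (s l - (s j)⁻¹))
          * (1 / (r - (s j)⁻¹) - 1 / (r - s j)) := by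
    rw [Finset.sum_mul_sum]
    simp_rw [hdouble, Finset.sum_sub_distrib]
    rw [Finset.sum_comm]
    simp_rw [mul_sub, Finset.sum_sub_distrib, Finset.mul_sum, Finset.sum_mul]
  have hS : (∑ j, a j / (s j - r)) * r⁻¹
      = (∑ j, a j * (s j)⁻¹) / r - ∑ j, a j * (s j)⁻¹ * (1 / (r - s j)) := by
    rw [Finset.sum_mul, Finset.sum_div, ← Finset.sum_sub_distrib]
    exact Finset.sum_congr rfl fun j _ => hsingle j
  have hR : ∑ j, a j * (s j)⁻¹ * (1 + ∑ l, a l / (s l - (s j)⁻¹))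
          * (1 / (r - (s j)⁻¹) - 1 / (r - s j))
      = (∑ j, a j * (s j)⁻¹ / (r - (s j)⁻¹)) - (∑ j, a j * (s j)⁻¹ * (1 / (r - s j)))
        + ∑ j, a j * (s j)⁻¹ * (∑ l, a l / (s l - (s j)⁻¹))
          * (1 / (r - (s j)⁻¹) - 1 / (r - s j)) := by
    rw [← Finset.sum_sub_distrib, ← Finset.sum_add_distrib]
    exact Finset.sum_congr rfl fun j _ => by ring
  rw [hR, ← hD]
  linear_combination hS

lemma hasDerivAt_arctan_shift {σ : ℝ} (hσ : σ ≠ 0) (c r : ℝ) :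
    HasDerivAt (fun r => Real.arctan ((r - c) / σ)) (σ / ((r - c) ^ 2 + σ ^ 2)) r := by
  have h := (((hasDerivAt_id r).sub_const c).div_const σ).arctan
  refine h.congr_deriv ?_
  have : (r - c) ^ 2 + σ ^ 2 ≠ 0 := by positivity
  simp only [id]
  field_simp
  ring

lemma tendsto_arctan_shift_atTop {σ : ℝ} (hσ : 0 < σ) (c : ℝ) :
    Tendsto (fun r : ℝ => Real.arctan ((r - c) / σ)) atTop (𝓝 (Real.pi / 2)) :=
  (tendsto_nhds_of_tendsto_nhdsWithin Real.tendsto_arctan_atTop).comp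
    ((tendsto_atTop_add_const_right atTop (-c) tendsto_id).atTop_div_const hσ)

lemma arctan_neg_cos_div_sin {θ : ℝ} (hθ : θ ∈ Set.Ioo 0 Real.pi) :
    Real.arctan ((0 - Real.cos θ) / Real.sin θ) = θ - Real.pi / 2 := by
  rw [← Real.arctan_tan (x := θ - Real.pi / 2) (by linarith [hθ.1]) (by linarith [hθ.2]),
    Real.tan_eq_sin_div_cos, Real.sin_sub_pi_div_two, Real.cos_sub_pi_div_two, zero_sub]

lemma integrableOn_Ioi_poisson {θ : ℝ} (hθ : θ ∈ Set.Ioo 0 Real.pi) :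
    IntegrableOn (fun r : ℝ => Real.sin θ / ((r - Real.cos θ) ^ 2 + Real.sin θ ^ 2))
      (Set.Ioi 0) := by
  have hσ := Real.sin_pos_of_mem_Ioo hθ
  exact integrableOn_Ioi_deriv_of_nonneg' (fun r _ => hasDerivAt_arctan_shift hσ.ne' _ r)
    (fun r _ => by positivity) (tendsto_arctan_shift_atTop hσ _)

lemma integral_Ioi_poisson {θ : ℝ} (hθ : θ ∈ Set.Ioo 0 Real.pi) :
    ∫ r in Set.Ioi (0 : ℝ), Real.sin θ / ((r - Real.cos θ) ^ 2 + Real.sin θ ^ 2)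
      = Real.pi - θ := by
  have hσ := Real.sin_pos_of_mem_Ioo hθ
  rw [integral_Ioi_of_hasDerivAt_of_nonneg' (fun r _ => hasDerivAt_arctan_shift hσ.ne' _ r)
    (fun r _ => by positivity) (tendsto_arctan_shift_atTop hσ _), arctan_neg_cos_div_sin hθ]
  ring

lemma poisson_neg (θ r : ℝ) :
    Real.sin θ / ((-r - Real.cos θ) ^ 2 + Real.sin θ ^ 2)
      = Real.sin (Real.pi - θ)
        / ((r - Real.cos (Real.pi - θ)) ^ 2 + Real.sin (Real.pi - θ) ^ 2) := by
  rw [Real.sin_pi_sub, Real.cos_pi_sub]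
  congr 1
  ring

lemma pi_sub_mem_Ioo {θ : ℝ} (hθ : θ ∈ Set.Ioo 0 Real.pi) :
    Real.pi - θ ∈ Set.Ioo 0 Real.pi :=
  ⟨by linarith [hθ.2], by linarith [hθ.1]⟩

lemma integrableOn_Iio_poisson {θ : ℝ} (hθ : θ ∈ Set.Ioo 0 Real.pi) :
    IntegrableOn (fun r : ℝ => Real.sin θ / ((r - Real.cos θ) ^ 2 + Real.sin θ ^ 2))
      (Set.Iio 0) := by
  have h := integrableOn_Ioi_poisson (pi_sub_mem_Ioo hθ)
  simp_rw [← poisson_neg] at h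
  rw [← neg_zero (G := ℝ)] at h
  simpa using h.comp_neg_Iio

lemma integral_Iio_poisson {θ : ℝ} (hθ : θ ∈ Set.Ioo 0 Real.pi) :
    ∫ r in Set.Iio (0 : ℝ), Real.sin θ / ((r - Real.cos θ) ^ 2 + Real.sin θ ^ 2) = θ := by
  have h := integral_Ioi_poisson (pi_sub_mem_Ioo hθ)
  simp_rw [← poisson_neg] at h
  rw [integral_comp_neg_Ioi (0 : ℝ)
    (fun r => Real.sin θ / ((r - Real.cos θ) ^ 2 + Real.sin θ ^ 2)), neg_zero,
    integral_Iic_eq_integral_Iio] at h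
  rw [h]
  ring

/-- On the unit circle, a pole and its complex conjugate combine to a Poisson kernel. -/
lemma one_div_sub_sub_one_div_sub {θ : ℝ} (hθ : θ ∈ Set.Ioo 0 Real.pi) (r : ℝ) :
    1 / ((r : ℂ) - (Complex.exp (Complex.I * θ))⁻¹) - 1 / ((r : ℂ) - Complex.exp (Complex.I * θ))
      = -(2 * Complex.I)
        * ((Real.sin θ / ((r - Real.cos θ) ^ 2 + Real.sin θ ^ 2) : ℝ) : ℂ) := by
  have hσ := Real.sin_pos_of_mem_Ioo hθ
  have e1 : Complex.exp (Complex.I * θ) = (Real.cos θ : ℂ) + (Real.sin θ : ℂ) * Complex.I := by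
    rw [mul_comm, Complex.exp_mul_I]; push_cast; rfl
  have e2 : (Complex.exp (Complex.I * θ))⁻¹
      = (Real.cos θ : ℂ) - (Real.sin θ : ℂ) * Complex.I := by
    rw [← Complex.exp_neg, ← mul_neg, mul_comm, ← Complex.ofReal_neg, Complex.exp_mul_I]
    push_cast
    rw [Complex.cos_neg, Complex.sin_neg]
    ring
  rw [e2, e1]
  generalize Real.sin θ = σ at *
  generalize Real.cos θ = c at *
  have h1 : (r : ℂ) - (c - σ * Complex.I) ≠ 0 := fun h => hσ.ne' (by
    simpa using congrArg Complex.im h)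
  have h2 : (r : ℂ) - (c + σ * Complex.I) ≠ 0 := fun h => hσ.ne' (by
    simpa using congrArg Complex.im h)
  have h3 : ((r : ℂ) - c) ^ 2 + (σ : ℂ) ^ 2 ≠ 0 := by
    have : (r - c) ^ 2 + σ ^ 2 ≠ 0 := by positivity
    exact_mod_cast this
  push_cast
  rw [div_sub_div _ _ h1 h2, mul_div_assoc', div_eq_div_iff (mul_ne_zero h1 h2) h3]
  ring_nf
  simp only [show Complex.I ^ 3 = -Complex.I by
    rw [pow_succ, Complex.I_sq]; ring]
  ring

/-- The solutions of `(1 + G x) *ᵥ f x = e x` tend to zero when `G` and `e` do. -/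
lemma tendsto_zero_of_one_add_mulVec {n : ℕ} {α : Type*} {F : Filter α}
    {G : α → Matrix (Fin n) (Fin n) ℂ} {f e : α → Fin n → ℂ}
    (hG : Tendsto G F (𝓝 0)) (he : Tendsto e F (𝓝 0))
    (hf : ∀ x, (1 + G x) *ᵥ f x = e x) : Tendsto f F (𝓝 0) := by
  have h1 : Tendsto (fun x => 1 + G x) F (𝓝 1) := by simpa using hG.const_add 1
  have hdet : Tendsto (fun x => (1 + G x).det) F (𝓝 1) := by
    simpa [Function.comp_def] using ((continuous_id.matrix_det (n := Fin n) (R := ℂ)).tendsto 1).comp h1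
  have hcont : Continuous fun p : Matrix (Fin n) (Fin n) ℂ × (Fin n → ℂ) =>
      p.1.adjugate *ᵥ p.2 :=
    (continuous_fst.matrix_adjugate).matrix_mulVec continuous_snd
  have hadj : Tendsto (fun x => (1 + G x).adjugate *ᵥ e x) F (𝓝 0) := by
    simpa [Function.comp_def] using (hcont.tendsto (1, 0)).comp (h1.prodMk_nhds he)
  have hmul : Tendsto (fun x => (1 + G x).det⁻¹ • ((1 + G x).adjugate *ᵥ e x)) F (𝓝 0) := by
    simpa using (hdet.inv₀ one_ne_zero).smul hadj
  refine hmul.congr' ?_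
  filter_upwards [hdet.eventually_ne one_ne_zero] with x hx
  rw [← hf x, mulVec_mulVec, adjugate_mul, smul_mulVec, one_mulVec, smul_smul,
    inv_mul_cancel₀ hx, one_smul]

/-- Real multiples of the points `exp (-i θ j)` with a common sine are independent. -/
lemma eq_zero_of_sum_exp_eq_zero {ι : Type*} {θ : ι → ℝ}
    (hθ : ∀ j, θ j ∈ Set.Ioo 0 Real.pi) (hinj : Function.Injective θ) (S : Finset ι)
    {j₀ : ι} (hj₀ : j₀ ∈ S) (hsin : ∀ j ∈ S, Real.sin (θ j) = Real.sin (θ j₀)) (b : ι → ℝ)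
    (hb : ∑ j ∈ S, (b j : ℂ) * (Complex.exp (Complex.I * (θ j : ℂ)))⁻¹ = 0) : b j₀ = 0 := by
  have hcosinj : ∀ j, Real.cos (θ j) = Real.cos (θ j₀) → j = j₀ := fun j h =>
    hinj (Real.injOn_cos ⟨(hθ j).1.le, (hθ j).2.le⟩ ⟨(hθ j₀).1.le, (hθ j₀).2.le⟩ h)
  have hcos : ∀ j ∈ S, j ≠ j₀ → Real.cos (θ j) = -Real.cos (θ j₀) := by
    intro j hj hne
    have h1 := Real.sin_sq_add_cos_sq (θ j)
    have h2 := Real.sin_sq_add_cos_sq (θ j₀)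
    rw [hsin j hj] at h1
    exact (sq_eq_sq_iff_eq_or_eq_neg.1 (by linarith)).resolve_left (mt (hcosinj j) hne)
  have hterm : ∀ j, (b j : ℂ) * (Complex.exp (Complex.I * (θ j : ℂ)))⁻¹
      = ((b j * Real.cos (θ j) : ℝ) : ℂ) - ((b j * Real.sin (θ j) : ℝ) : ℂ) * Complex.I := by
    intro j
    rw [← Complex.exp_neg, ← mul_neg, mul_comm Complex.I, ← Complex.ofReal_neg, Complex.exp_mul_I]
    push_cast
    rw [Complex.cos_neg, Complex.sin_neg]
    ring
  simp_rw [hterm] at hb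
  have hre : ∑ j ∈ S, b j * Real.cos (θ j) = 0 := by
    simpa [-Complex.ofReal_mul, Complex.re_sum, Complex.sub_re] using congrArg Complex.re hb
  have him : Real.sin (θ j₀) * ∑ j ∈ S, b j = 0 := by
    have : ∑ j ∈ S, b j * Real.sin (θ j) = 0 := by
      simpa [-Complex.ofReal_mul, Complex.im_sum, Complex.sub_im] using congrArg Complex.im hb
    rw [← this, Finset.mul_sum]
    exact Finset.sum_congr rfl fun j hj => by rw [hsin j hj, mul_comm]
  have hsum := (mul_eq_zero.1 him).resolve_left (Real.sin_pos_of_mem_Ioo (hθ j₀)).ne'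
  by_cases hc : Real.cos (θ j₀) = 0
  · rwa [Finset.sum_eq_single_of_mem j₀ hj₀ fun j hj hne => absurd
      (hcosinj j (by rw [hcos j hj hne, hc, neg_zero])) hne] at hsum
  · have h : ∑ j ∈ S, b j * (Real.cos (θ j) + Real.cos (θ j₀)) = 0 := by
      simp_rw [mul_add, Finset.sum_add_distrib, ← Finset.sum_mul, hre, hsum]
      simp
    rw [Finset.sum_eq_single_of_mem j₀ hj₀ fun j hj hne => by rw [hcos j hj hne]; ring] at h
    exact (mul_eq_zero.1 h).resolve_right fun h' => hc (by linarith)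

/-- Real coefficients of functions `exp (-i θ j) exp (2 κ j x) h j x`, with `κ j` proportional to
`sin (θ j)` and `h j` having a nonzero real limit at `-∞`, vanish if the linear combination does. -/
lemma eq_zero_of_sum_exp_mul_eq_zero {n : ℕ} {θ κ : Fin n → ℝ} {m : ℝ} (hm : 0 < m)
    (hθ : ∀ j, θ j ∈ Set.Ioo 0 Real.pi) (hinj : Function.Injective θ)
    (hκ : ∀ j, κ j = m * Real.sin (θ j)) (h : Fin n → ℝ → ℂ) (B : Fin n → ℝ)
    (hB : ∀ j, B j ≠ 0) (hh : ∀ j, Tendsto (h j) atBot (𝓝 (B j : ℂ))) (μ : Fin n → ℝ)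
    (hsum : ∀ x : ℝ, ∑ j, (μ j : ℂ) * (Complex.exp (Complex.I * (θ j : ℂ)))⁻¹
      * ((Real.exp (2 * κ j * x) : ℂ) * h j x) = 0) : ∀ j, μ j = 0 := by
  by_contra! hne
  obtain ⟨j₀, hj₀, hmin⟩ := Finset.exists_min_image (Finset.univ.filter fun j => μ j ≠ 0) κ
    (by obtain ⟨j, hj⟩ := hne; exact ⟨j, by simpa using hj⟩)
  simp only [Finset.mem_filter, Finset.mem_univ, true_and] at hj₀ hmin
  have hterm : ∀ j, Tendsto (fun x : ℝ => (μ j : ℂ) * (Complex.exp (Complex.I * (θ j : ℂ)))⁻¹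
      * ((Real.exp (2 * (κ j - κ j₀) * x) : ℂ) * h j x)) atBot
      (𝓝 (if κ j = κ j₀ then
        ((μ j * B j : ℝ) : ℂ) * (Complex.exp (Complex.I * (θ j : ℂ)))⁻¹ else 0)) := by
    intro j
    split_ifs with hj
    · convert (hh j).const_mul ((μ j : ℂ) * (Complex.exp (Complex.I * (θ j : ℂ)))⁻¹) using 2
      · simp [hj]
      · push_cast; ring
    · by_cases hμ : μ j = 0
      · simp [hμ]
      · have hpos : 0 < 2 * (κ j - κ j₀) := by
          linarith [lt_of_le_of_ne (hmin j hμ) (Ne.symm hj)]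
        have he : Tendsto (fun x : ℝ => ((Real.exp (2 * (κ j - κ j₀) * x) : ℝ) : ℂ)) atBot
            (𝓝 ((0 : ℝ) : ℂ)) :=
          (Complex.continuous_ofReal.tendsto 0).comp
            (Real.tendsto_exp_atBot.comp (tendsto_id.const_mul_atBot hpos))
        simpa using (he.mul (hh j)).const_mul
          ((μ j : ℂ) * (Complex.exp (Complex.I * (θ j : ℂ)))⁻¹)
  have hzero : (fun x : ℝ => ∑ j, (μ j : ℂ) * (Complex.exp (Complex.I * (θ j : ℂ)))⁻¹
      * ((Real.exp (2 * (κ j - κ j₀) * x) : ℂ) * h j x)) = fun _ => 0 := by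
    funext x
    rw [← mul_zero ((Real.exp (-(2 * κ j₀ * x)) : ℝ) : ℂ), ← hsum x, Finset.mul_sum]
    refine Finset.sum_congr rfl fun j _ => ?_
    rw [show 2 * (κ j - κ j₀) * x = -(2 * κ j₀ * x) + 2 * κ j * x by ring, Real.exp_add]
    push_cast
    ring
  have hlim := tendsto_finsetSum Finset.univ fun j _ => hterm j
  rw [hzero, ← Finset.sum_filter] at hlim
  have := eq_zero_of_sum_exp_eq_zero hθ hinj _ (j₀ := j₀) (by simp)
    (fun j hj => by
      have hj' : κ j = κ j₀ := by simpa using hj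
      rw [hκ, hκ] at hj'
      exact mul_left_cancel₀ hm.ne' hj') _ (tendsto_nhds_unique tendsto_const_nhds hlim).symm
  exact (mul_ne_zero hj₀ (hB j₀)) this

/-- Main Theorem: in the `n`-soliton setup, with filling rates `ν₁, …, νₙ ∈ ℝ`, the
integrand `s ↦ (m/2)·u(x,s)·conj(v(x,s)) − Δ(x)/(2s)` is integrable on `(−∞,0)` and
`(0,∞)` for every `x`, and the gap equation
`0 = Σ_j ν_j s_j⁻¹ f_j(x)² + [∫_{−∞}^0 − ∫_0^∞](ds/2π)((m/2) u conj v − Δ/(2s))`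
holds for every `x` if and only if `ν_j = (2θ_j − π)/π` for every `j`. -/
theorem nsoliton_gap_equation_iff_filling
    (m : ℝ) (hm : 0 < m) (n : ℕ) (hn : 1 ≤ n)
    (θ xc : Fin n → ℝ) (hθ : ∀ j, θ j ∈ Set.Ioo 0 Real.pi)
    (hθinj : Function.Injective θ)
    (s : Fin n → ℂ) (hs : ∀ j, s j = Complex.exp (Complex.I * (θ j : ℂ)))
    (κ : Fin n → ℝ) (hκ : ∀ j, κ j = m * Real.sin (θ j))
    (e : Fin n → ℝ → ℝ)
    (he : ∀ j x, e j x = Real.sqrt (κ j) * Real.exp (κ j * (x - xc j)))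
    (G : ℝ → Matrix (Fin n) (Fin n) ℂ)
    (hG : ∀ x j l, G x j l
      = -(2 * Complex.I / (m : ℂ)) * (e j x : ℂ) * (e l x : ℂ) / ((s j)⁻¹ - s l))
    (hinv : ∀ x : ℝ, IsUnit (1 + G x))
    (f : ℝ → Fin n → ℂ)
    (hf : ∀ x : ℝ, (1 + G x) *ᵥ (f x) = fun j => -((e j x : ℂ)))
    (hfd : ∀ j, Differentiable ℝ (fun x => f x j))
    (Δ : ℝ → ℂ)
    (hΔ : ∀ x : ℝ, Δ x = (m : ℂ) + 2 * Complex.I * ∑ j, (s j)⁻¹ * (e j x : ℂ) * f x j)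
    (ν : Fin n → ℝ)
    (u v : ℝ → ℝ → ℂ)
    (hu : ∀ (x : ℝ) (sr : ℝ),
      u x sr = Complex.exp (Complex.I * ((m / 2 * (sr - sr⁻¹) : ℝ) : ℂ) * x)
        * (1 + (2 * Complex.I / (m : ℂ))
            * ∑ j, (e j x : ℂ) * f x j / (s j - (sr : ℂ))))
    (hv : ∀ (x : ℝ) (sr : ℝ),
      v x sr = Complex.exp (Complex.I * ((m / 2 * (sr - sr⁻¹) : ℝ) : ℂ) * x)
        * (((sr : ℂ))⁻¹ + (2 * Complex.I / (m : ℂ))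
            * ∑ j, (e j x : ℂ) * s j * (starRingEnd ℂ) (f x j) / (s j - (sr : ℂ)))) :
    (∀ x : ℝ,
      IntegrableOn (fun sr : ℝ =>
          ((m : ℂ) / 2) * u x sr * (starRingEnd ℂ) (v x sr) - Δ x / (2 * (sr : ℂ)))
        (Set.Iio 0) ∧
      IntegrableOn (fun sr : ℝ =>
          ((m : ℂ) / 2) * u x sr * (starRingEnd ℂ) (v x sr) - Δ x / (2 * (sr : ℂ)))
        (Set.Ioi 0)) ∧
    ((∀ x : ℝ,
        (0 : ℂ) = (∑ j, (ν j : ℂ) * (s j)⁻¹ * (f x j) ^ 2)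
          + (1 / (2 * (Real.pi : ℂ)))
              * ((∫ sr in Set.Iio (0 : ℝ),
                    (((m : ℂ) / 2) * u x sr * (starRingEnd ℂ) (v x sr)
                      - Δ x / (2 * (sr : ℂ))))
                - (∫ sr in Set.Ioi (0 : ℝ),
                    (((m : ℂ) / 2) * u x sr * (starRingEnd ℂ) (v x sr)
                      - Δ x / (2 * (sr : ℂ))))))
      ↔ (∀ j, ν j = (2 * θ j - Real.pi) / Real.pi)) := by
  have hsin : ∀ j, 0 < Real.sin (θ j) := fun j => Real.sin_pos_of_mem_Ioo (hθ j)
  have hs0 : ∀ j, s j ≠ 0 := fun j => by rw [hs]; exact Complex.exp_ne_zero _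
  have hsim : ∀ j, (s j).im = Real.sin (θ j) := fun j => by
    rw [hs, mul_comm, Complex.exp_ofReal_mul_I_im]
  have hsconj : ∀ j, (s j)⁻¹ = starRingEnd ℂ (s j) := fun j => by
    rw [hs, ← Complex.exp_neg, ← Complex.exp_conj]
    simp
  have htim : ∀ j, ((s j)⁻¹).im = -Real.sin (θ j) := fun j => by
    rw [hsconj, Complex.conj_im, hsim]
  have hsr : ∀ (r : ℝ) j, s j - (r : ℂ) ≠ 0 := fun r j h => (hsin j).ne' (by
    simpa [hsim] using congrArg Complex.im h)
  have htr : ∀ (r : ℝ) j, (r : ℂ) - (s j)⁻¹ ≠ 0 := fun r j h => (hsin j).ne' (by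
    simpa [htim, -Complex.inv_im] using congrArg Complex.im h)
  have hst : ∀ j l, s j - (s l)⁻¹ ≠ 0 := fun j l h => by
    have := congrArg Complex.im h
    rw [Complex.sub_im, hsim, htim, Complex.zero_im] at this
    linarith [hsin j, hsin l]
  have hmC : (m : ℂ) ≠ 0 := by exact_mod_cast hm.ne'
  have hκ0 : ∀ j, 0 < κ j := fun j => by rw [hκ]; exact mul_pos hm (hsin j)
  -- the linear system, read as the value of `u` at the mirrored pole
  have hfe : ∀ x j, f x j
      = (e j x : ℂ) * -(1 + ∑ l, (2 * Complex.I / m * (e l x * f x l)) / (s l - (s j)⁻¹)) := by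
    intro x j
    have hfx := hf x
    rw [add_mulVec, one_mulVec] at hfx
    have h := congrFun hfx j
    simp only [Pi.add_apply, mulVec, dotProduct, hG] at h
    have h2 : ∑ l, -(2 * Complex.I / (m : ℂ)) * (e j x : ℂ) * (e l x : ℂ) / ((s j)⁻¹ - s l) * f x l
        = (e j x : ℂ) * ∑ l, (2 * Complex.I / m * (e l x * f x l)) / (s l - (s j)⁻¹) := by
      rw [Finset.mul_sum]
      refine Finset.sum_congr rfl fun l _ => ?_
      rw [← neg_sub (s l), div_neg]
      ring
    rw [h2] at h
    linear_combination h
  have hint : ∀ x r : ℝ, r ≠ 0 →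
      (m : ℂ) / 2 * u x r * (starRingEnd ℂ) (v x r) - Δ x / (2 * (r : ℂ))
        = ∑ j, -2 * ((s j)⁻¹ * f x j ^ 2)
          * ((Real.sin (θ j) / ((r - Real.cos (θ j)) ^ 2 + Real.sin (θ j) ^ 2) : ℝ) : ℂ) := by
    intro x r hr
    have hpf := mul_partial_fractions s (fun j => 2 * Complex.I / m * (e j x * f x j)) (r : ℂ)
      (by exact_mod_cast hr) hs0 (hsr r) (htr r) hst
    have hphase : Complex.exp (Complex.I * ((m / 2 * (r - r⁻¹) : ℝ) : ℂ) * x)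
        * (starRingEnd ℂ) (Complex.exp (Complex.I * ((m / 2 * (r - r⁻¹) : ℝ) : ℂ) * x)) = 1 := by
      rw [← Complex.exp_conj, ← Complex.exp_add, map_mul, map_mul, Complex.conj_I,
        Complex.conj_ofReal, Complex.conj_ofReal, ← Complex.exp_zero]
      congr 1
      ring
    have hu' : 1 + (2 * Complex.I / (m : ℂ)) * ∑ j, (e j x : ℂ) * f x j / (s j - (r : ℂ))
        = 1 + ∑ j, 2 * Complex.I / m * (e j x * f x j) / (s j - (r : ℂ)) := by
      rw [Finset.mul_sum]
      simp_rw [mul_div_assoc]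
    have hv' : (starRingEnd ℂ) (((r : ℂ))⁻¹ + (2 * Complex.I / (m : ℂ))
            * ∑ j, (e j x : ℂ) * s j * (starRingEnd ℂ) (f x j) / (s j - (r : ℂ)))
        = (r : ℂ)⁻¹ + ∑ j, 2 * Complex.I / m * (e j x * f x j) * (s j)⁻¹ / (r - (s j)⁻¹) := by
      simp only [map_add, map_mul, map_sum, map_div₀, map_inv₀, map_sub, Complex.conj_ofReal,
        Complex.conj_I, Complex.conj_conj, ← hsconj, map_ofNat, Finset.mul_sum]
      congr 1
      refine Finset.sum_congr rfl fun j _ => ?_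
      rw [← neg_sub (r : ℂ), div_neg]
      ring
    have hΔ' : Δ x = m * (1 + ∑ j, 2 * Complex.I / m * (e j x * f x j) * (s j)⁻¹) := by
      rw [hΔ, mul_add, mul_one, Finset.mul_sum, Finset.mul_sum]
      congr 1
      refine Finset.sum_congr rfl fun j _ => ?_
      field_simp
    have hr' : (r : ℂ) ≠ 0 := by exact_mod_cast hr
    rw [hu, hv, hΔ', map_mul, hv', hu']
    generalize Complex.exp (Complex.I * ((m / 2 * (r - r⁻¹) : ℝ) : ℂ) * x) = E at hphase ⊢
    calc _ = (m : ℂ) / 2 * ((1 + ∑ j, 2 * Complex.I / m * (e j x * f x j) / (s j - (r : ℂ)))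
          * ((r : ℂ)⁻¹ + ∑ j, 2 * Complex.I / m * (e j x * f x j) * (s j)⁻¹ / (r - (s j)⁻¹))
          - (1 + ∑ j, 2 * Complex.I / m * (e j x * f x j) * (s j)⁻¹) / r) := by
          rw [mul_sub]
          congr 1
          · linear_combination ((m : ℂ) / 2
              * (1 + ∑ j, 2 * Complex.I / m * (e j x * f x j) / (s j - (r : ℂ)))
              * ((r : ℂ)⁻¹ + ∑ j, 2 * Complex.I / m * (e j x * f x j) * (s j)⁻¹
                / (r - (s j)⁻¹))) * hphase
          · field_simp
      _ = _ := by
          rw [hpf, Finset.mul_sum]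
          refine Finset.sum_congr rfl fun j _ => ?_
          have hker := one_div_sub_sub_one_div_sub (hθ j) r
          rw [← hs j] at hker
          rw [hker]
          have hfj := hfe x j
          generalize (1 + ∑ l, 2 * Complex.I / m * (e l x * f x l) / (s l - (s j)⁻¹)) = w at *
          generalize ((Real.sin (θ j) / ((r - Real.cos (θ j)) ^ 2 + Real.sin (θ j) ^ 2) : ℝ) : ℂ)
            = p at *
          have hc : (m : ℂ) / 2 * (2 * Complex.I / m) = Complex.I := by field_simp
          linear_combination (e j x * f x j * (s j)⁻¹ * w * (-(2 * Complex.I) * p)) * hc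
            + (-2 * e j x * f x j * (s j)⁻¹ * w * p) * Complex.I_mul_I
            + (2 * f x j * p * (s j)⁻¹) * hfj
  have hI1 : ∀ j, IntegrableOn (fun r : ℝ => ((Real.sin (θ j)
      / ((r - Real.cos (θ j)) ^ 2 + Real.sin (θ j) ^ 2) : ℝ) : ℂ)) (Set.Iio 0) :=
    fun j => (integrableOn_Iio_poisson (hθ j)).ofReal
  have hI2 : ∀ j, IntegrableOn (fun r : ℝ => ((Real.sin (θ j)
      / ((r - Real.cos (θ j)) ^ 2 + Real.sin (θ j) ^ 2) : ℝ) : ℂ)) (Set.Ioi 0) :=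
    fun j => (integrableOn_Ioi_poisson (hθ j)).ofReal
  have hneg : ∀ x, Set.EqOn (fun r : ℝ =>
      (m : ℂ) / 2 * u x r * (starRingEnd ℂ) (v x r) - Δ x / (2 * (r : ℂ)))
      (fun r : ℝ => ∑ j, -2 * ((s j)⁻¹ * f x j ^ 2)
        * ((Real.sin (θ j) / ((r - Real.cos (θ j)) ^ 2 + Real.sin (θ j) ^ 2) : ℝ) : ℂ))
      (Set.Iio 0) := fun x r hr => hint x r (ne_of_lt hr)
  have hpos : ∀ x, Set.EqOn (fun r : ℝ =>
      (m : ℂ) / 2 * u x r * (starRingEnd ℂ) (v x r) - Δ x / (2 * (r : ℂ)))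
      (fun r : ℝ => ∑ j, -2 * ((s j)⁻¹ * f x j ^ 2)
        * ((Real.sin (θ j) / ((r - Real.cos (θ j)) ^ 2 + Real.sin (θ j) ^ 2) : ℝ) : ℂ))
      (Set.Ioi 0) := fun x r hr => hint x r (ne_of_gt hr)
  refine ⟨fun x => ⟨?_, ?_⟩, ?_⟩
  · exact (integrableOn_congr_fun (hneg x) measurableSet_Iio).2
      (integrable_finsetSum _ fun j _ => (hI1 j).const_mul _)
  · exact (integrableOn_congr_fun (hpos x) measurableSet_Ioi).2
      (integrable_finsetSum _ fun j _ => (hI2 j).const_mul _)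
  have hpi : (Real.pi : ℂ) ≠ 0 := by exact_mod_cast Real.pi_ne_zero
  have hgap : ∀ x : ℝ, (∑ j, (ν j : ℂ) * (s j)⁻¹ * (f x j) ^ 2)
      + (1 / (2 * (Real.pi : ℂ)))
        * ((∫ sr in Set.Iio (0 : ℝ),
              (((m : ℂ) / 2) * u x sr * (starRingEnd ℂ) (v x sr) - Δ x / (2 * (sr : ℂ))))
          - (∫ sr in Set.Ioi (0 : ℝ),
              (((m : ℂ) / 2) * u x sr * (starRingEnd ℂ) (v x sr) - Δ x / (2 * (sr : ℂ)))))
      = ∑ j, ((ν j - (2 * θ j - Real.pi) / Real.pi : ℝ) : ℂ) * (s j)⁻¹ * f x j ^ 2 := by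
    intro x
    rw [setIntegral_congr_fun measurableSet_Iio (hneg x),
      setIntegral_congr_fun measurableSet_Ioi (hpos x),
      integral_finsetSum _ fun j _ => (hI1 j).const_mul _,
      integral_finsetSum _ fun j _ => (hI2 j).const_mul _, ← Finset.sum_sub_distrib,
      Finset.mul_sum, ← Finset.sum_add_distrib]
    refine Finset.sum_congr rfl fun j _ => ?_
    rw [integral_const_mul, integral_const_mul, integral_complex_ofReal,
      integral_complex_ofReal, integral_Iio_poisson (hθ j), integral_Ioi_poisson (hθ j)]
    push_cast
    field_simp
    ring
  simp_rw [hgap]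
  constructor
  · intro h
    have he0 : ∀ j, Tendsto (fun x => (e j x : ℂ)) atBot (𝓝 0) := by
      intro j
      have h1 : Tendsto (fun x => e j x) atBot (𝓝 0) := by
        simp_rw [he]
        simpa [Function.comp_def, ← sub_eq_add_neg] using ((Real.tendsto_exp_atBot.comp ((tendsto_atBot_add_const_right atBot (-xc j)
          tendsto_id).const_mul_atBot (hκ0 j))).const_mul (Real.sqrt (κ j)))
      exact_mod_cast (Complex.continuous_ofReal.tendsto 0).comp h1
    have hG0 : Tendsto G atBot (𝓝 0) := by
      refine tendsto_pi_nhds.2 fun j => tendsto_pi_nhds.2 fun l => ?_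
      simp_rw [hG]
      simpa using (((he0 j).const_mul (-(2 * Complex.I / (m : ℂ)))).mul (he0 l)).div_const
        ((s j)⁻¹ - s l)
    have hf0 : Tendsto f atBot (𝓝 0) := by
      refine tendsto_zero_of_one_add_mulVec hG0 (tendsto_pi_nhds.2 fun j => ?_) hf
      simpa using (he0 j).neg
    have hw : ∀ j, Tendsto (fun x => -(1 + ∑ l, (2 * Complex.I / m * (e l x * f x l))
        / (s l - (s j)⁻¹))) atBot (𝓝 (-1)) := by
      intro j
      have h1 := tendsto_finsetSum Finset.univ fun l _ =>
        (((he0 l).mul (tendsto_pi_nhds.1 hf0 l)).const_mul (2 * Complex.I / (m : ℂ))).div_const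
          (s l - (s j)⁻¹)
      simpa using (h1.const_add 1).neg
    have hlim : ∀ j, Tendsto (fun x => ((κ j * Real.exp (-(2 * κ j * xc j)) : ℝ) : ℂ)
        * (-(1 + ∑ l, (2 * Complex.I / m * (e l x * f x l)) / (s l - (s j)⁻¹))) ^ 2) atBot
        (𝓝 ((κ j * Real.exp (-(2 * κ j * xc j)) : ℝ) : ℂ)) := by
      intro j
      have h1 := ((hw j).pow 2).const_mul ((κ j * Real.exp (-(2 * κ j * xc j)) : ℝ) : ℂ)
      rwa [neg_one_sq, mul_one] at h1
    have hμ := eq_zero_of_sum_exp_mul_eq_zero hm hθ hθinj hκ _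
      (fun j => κ j * Real.exp (-(2 * κ j * xc j)))
      (fun j => (mul_pos (hκ0 j) (Real.exp_pos _)).ne') hlim
      (fun j => ν j - (2 * θ j - Real.pi) / Real.pi)
      (fun x => by
        rw [h x]
        refine Finset.sum_congr rfl fun j _ => ?_
        have hsq : e j x ^ 2
            = Real.exp (2 * κ j * x) * (κ j * Real.exp (-(2 * κ j * xc j))) := by
          rw [he, mul_pow, Real.sq_sqrt (hκ0 j).le, ← Real.exp_nat_mul, mul_left_comm (Real.exp _),
            ← Real.exp_add]
          congr 2
          push_cast
          ring
        rw [← hs j]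
        conv_rhs => rw [hfe x j, mul_pow, ← Complex.ofReal_pow, hsq]
        push_cast
        ring)
    exact fun j => sub_eq_zero.1 (hμ j)
  · intro h x
    refine (Finset.sum_eq_zero fun j _ => ?_).symm
    rw [h j]
    simp
end

section
/- (Reduction to real condensates, odd case) In the n-soliton setup with n = 2n' + 1 odd, suppose that for each j = 1, …, n' one has θ_{2j−1} = π − θ_{2j} (equivalently s_{2j−1} = −conj(s_{2j})) and x_{2j−1} = x_{2j}, and that θ_{2n'+1} = π/2 (i.e. s_{2n'+1} = i), with x_{2n'+1} ∈ ℝ arbitrary (all θ₁, …, θₙ still pairwise distinct). Then f_{2j−1}(x) = conj(f_{2j}(x)) for all x and all j = 1, …, n', f_{2n'+1}(x) is real for all x, and consequently Δ(x) is real for every x ∈ ℝ. -/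
open Matrix

/-- If an invertible linear system is conjugated by the index permutation `σ`, so is its
solution. -/
theorem mulVec_solution_conj_symm {ι : Type*} [Fintype ι] [DecidableEq ι] (σ : Equiv.Perm ι)
    {A : Matrix ι ι ℂ} (hA : IsUnit A) {v b : ι → ℂ} (hv : A *ᵥ v = b)
    (hAσ : ∀ j l, A (σ j) (σ l) = starRingEnd ℂ (A j l))
    (hbσ : ∀ j, b (σ j) = starRingEnd ℂ (b j)) (j : ι) :
    v (σ j) = starRingEnd ℂ (v j) := by
  have hw : A *ᵥ (fun l => starRingEnd ℂ (v (σ l))) = A *ᵥ v := by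
    rw [hv]
    ext j
    have h := congrFun hv (σ j)
    rw [hbσ, Matrix.mulVec, dotProduct, ← Equiv.sum_comp σ] at h
    have h' := congrArg (starRingEnd ℂ) h
    simp only [map_sum, map_mul, hAσ, Complex.conj_conj] at h'
    exact h'
  have hj := congrFun (Matrix.mulVec_injective_of_isUnit hA hw) j
  rw [← hj, Complex.conj_conj]

/-- The involution of `ℕ` exchanging `2j` and `2j + 1` for `j < k`, and fixing everything else. -/
def pairSwap (k i : ℕ) : ℕ := if 2 * k ≤ i then i else if i % 2 = 0 then i + 1 else i - 1

theorem pairSwap_pairSwap (k i : ℕ) : pairSwap k (pairSwap k i) = i := by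
  unfold pairSwap
  split_ifs <;> omega

theorem pairSwap_lt {k i : ℕ} (hi : i < 2 * k + 1) : pairSwap k i < 2 * k + 1 := by
  unfold pairSwap
  split_ifs <;> omega

/-- `pairSwap` as a permutation of `2k + 1` indices. -/
def pairSwapPerm (k : ℕ) : Equiv.Perm (Fin (2 * k + 1)) :=
  Function.Involutive.toPerm (fun i => ⟨pairSwap k i, pairSwap_lt i.isLt⟩)
    fun i => Fin.ext (pairSwap_pairSwap k i)

theorem pairSwapPerm_odd {k j : ℕ} (hj : j < k) :
    pairSwapPerm k ⟨2 * j + 1, by omega⟩ = ⟨2 * j, by omega⟩ := by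
  apply Fin.ext
  simp only [pairSwapPerm, Function.Involutive.coe_toPerm, pairSwap]
  split_ifs <;> omega

theorem pairSwapPerm_even {k j : ℕ} (hj : j < k) :
    pairSwapPerm k ⟨2 * j, by omega⟩ = ⟨2 * j + 1, by omega⟩ := by
  apply Fin.ext
  simp only [pairSwapPerm, Function.Involutive.coe_toPerm, pairSwap]
  split_ifs <;> omega

theorem pairSwapPerm_last (k : ℕ) :
    pairSwapPerm k ⟨2 * k, by omega⟩ = ⟨2 * k, by omega⟩ := by
  apply Fin.ext
  simp [pairSwapPerm, pairSwap]

/-- A relation between an index and its partner holds everywhere once it holds on each pair, in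
both orders, and at the last index. -/
theorem pairSwapPerm_forall {k : ℕ} {P : Fin (2 * k + 1) → Fin (2 * k + 1) → Prop}
    (hsymm : ∀ i j, P i j → P j i)
    (hpair : ∀ j : Fin k, P ⟨2 * (j : ℕ), by omega⟩ ⟨2 * (j : ℕ) + 1, by omega⟩)
    (hlast : P ⟨2 * k, by omega⟩ ⟨2 * k, by omega⟩) (i : Fin (2 * k + 1)) :
    P (pairSwapPerm k i) i := by
  obtain ⟨i, hi⟩ := i
  rcases Nat.even_or_odd' i with ⟨j, rfl | rfl⟩
  · rcases (show j ≤ k by omega).lt_or_eq with hj | rfl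
    · rw [pairSwapPerm_even hj]
      exact hsymm _ _ (hpair ⟨j, hj⟩)
    · rwa [pairSwapPerm_last]
  · have hj : j < k := by omega
    rw [pairSwapPerm_odd hj]
    exact hpair ⟨j, hj⟩

/-- Reduction to real condensates, odd case: in the `n`-soliton setup with `n = 2n' + 1`,
if `θ_{2j−1} = π − θ_{2j}` and `x_{2j−1} = x_{2j}` for each pair and `θ_{2n'+1} = π/2`
(with `x_{2n'+1}` arbitrary), then `f_{2j−1} = conj f_{2j}`, `f_{2n'+1}` is real-valued,
and `Δ(x)` is real for every `x`. -/
theorem nsoliton_real_reduction_odd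
    (m : ℝ) (hm : 0 < m) (n : ℕ) (hn : 1 ≤ n)
    (θ xc : Fin n → ℝ) (hθ : ∀ j, θ j ∈ Set.Ioo 0 Real.pi)
    (hθinj : Function.Injective θ)
    (s : Fin n → ℂ) (hs : ∀ j, s j = Complex.exp (Complex.I * (θ j : ℂ)))
    (κ : Fin n → ℝ) (hκ : ∀ j, κ j = m * Real.sin (θ j))
    (e : Fin n → ℝ → ℝ)
    (he : ∀ j x, e j x = Real.sqrt (κ j) * Real.exp (κ j * (x - xc j)))
    (G : ℝ → Matrix (Fin n) (Fin n) ℂ)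
    (hG : ∀ x j l, G x j l
      = -(2 * Complex.I / (m : ℂ)) * (e j x : ℂ) * (e l x : ℂ) / ((s j)⁻¹ - s l))
    (hinv : ∀ x : ℝ, IsUnit (1 + G x))
    (f : ℝ → Fin n → ℂ)
    (hf : ∀ x : ℝ, (1 + G x) *ᵥ (f x) = fun j => -((e j x : ℂ)))
    (hfd : ∀ j, Differentiable ℝ (fun x => f x j))
    (Δ : ℝ → ℂ)
    (hΔ : ∀ x : ℝ, Δ x = (m : ℂ) + 2 * Complex.I * ∑ j, (s j)⁻¹ * (e j x : ℂ) * f x j)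
    (n' : ℕ) (hn2 : n = 2 * n' + 1)
    (hpairθ : ∀ j : Fin n',
      θ ⟨2 * (j : ℕ), by have := j.isLt; omega⟩
        = Real.pi - θ ⟨2 * (j : ℕ) + 1, by have := j.isLt; omega⟩)
    (hpairx : ∀ j : Fin n',
      xc ⟨2 * (j : ℕ), by have := j.isLt; omega⟩
        = xc ⟨2 * (j : ℕ) + 1, by have := j.isLt; omega⟩)
    (hlast : θ ⟨2 * n', by omega⟩ = Real.pi / 2) :
    (∀ j : Fin n', ∀ x : ℝ,
      f x ⟨2 * (j : ℕ), by have := j.isLt; omega⟩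
        = (starRingEnd ℂ) (f x ⟨2 * (j : ℕ) + 1, by have := j.isLt; omega⟩)) ∧
    (∀ x : ℝ, (f x ⟨2 * n', by omega⟩).im = 0) ∧
    (∀ x : ℝ, (Δ x).im = 0) := by
  subst hn2
  set σ := pairSwapPerm n' with hσ
  have hθσ : ∀ j, θ (σ j) = Real.pi - θ j :=
    pairSwapPerm_forall (P := fun i j => θ i = Real.pi - θ j) (fun i j h => by linarith)
      hpairθ (by linarith)
  have heσ : ∀ j x, e (σ j) x = e j x := fun j x => by
    have hx : xc (σ j) = xc j :=
      pairSwapPerm_forall (P := fun i j => xc i = xc j) (fun i j h => h.symm) hpairx rfl j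
    rw [he, he, hκ, hκ, hθσ, Real.sin_pi_sub, hx]
  have hsconj : ∀ j, starRingEnd ℂ (s j) = (s j)⁻¹ := fun j => by
    rw [hs, ← Complex.exp_conj, ← Complex.exp_neg]
    simp
  have hsσ : ∀ j, s (σ j) = -(s j)⁻¹ := fun j => by
    rw [hs, hs, hθσ, ← Complex.exp_neg, Complex.ofReal_sub, mul_sub, sub_eq_add_neg,
      Complex.exp_add, mul_comm Complex.I (Real.pi : ℂ), Complex.exp_pi_mul_I, neg_one_mul]
  have hGσ : ∀ x j l, (1 + G x) (σ j) (σ l) = starRingEnd ℂ ((1 + G x) j l) := fun x j l => by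
    have hd : (s (σ j))⁻¹ - s (σ l) = -(s j - (s l)⁻¹) := by
      rw [hsσ, hsσ, inv_neg, inv_inv]
      ring
    have h1 : (1 : Matrix (Fin (2 * n' + 1)) (Fin (2 * n' + 1)) ℂ) (σ j) (σ l)
        = starRingEnd ℂ ((1 : Matrix (Fin (2 * n' + 1)) (Fin (2 * n' + 1)) ℂ) j l) := by
      simp only [Matrix.one_apply, σ.injective.eq_iff]
      split_ifs <;> simp
    rw [Matrix.add_apply, Matrix.add_apply, map_add, h1, hG, hG, hd, div_neg, heσ, heσ]
    simp only [map_div₀, map_mul, map_neg, map_sub, map_inv₀, hsconj, Complex.conj_I,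
      Complex.conj_ofReal, inv_inv, map_ofNat]
    ring
  have hfσ : ∀ x j, f x (σ j) = starRingEnd ℂ (f x j) := fun x =>
    mulVec_solution_conj_symm σ (hinv x) (hf x) (hGσ x) fun j => by simp [heσ]
  refine ⟨fun j x => ?_, fun x => ?_, fun x => ?_⟩
  · rw [← hfσ, hσ, pairSwapPerm_odd j.isLt]
  · rw [← Complex.conj_eq_iff_im, ← hfσ, hσ, pairSwapPerm_last]
  · have hsum : starRingEnd ℂ (∑ j, (s j)⁻¹ * (e j x : ℂ) * f x j)
        = -∑ j, (s j)⁻¹ * (e j x : ℂ) * f x j := by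
      conv_rhs => rw [← Equiv.sum_comp σ]
      rw [map_sum, ← Finset.sum_neg_distrib]
      refine Finset.sum_congr rfl fun j _ => ?_
      rw [hfσ, heσ, hsσ, map_mul, map_mul, map_inv₀, hsconj, Complex.conj_ofReal, inv_neg]
      ring
    rw [← Complex.conj_eq_iff_im, hΔ, map_add, map_mul, map_mul, hsum, Complex.conj_ofReal,
      Complex.conj_I, map_ofNat]
    ring
end
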